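/- Let 𝕂 be ℝ or ℂ and let Q = U A with U ∈ 𝕂^{μ×m}, A ∈ 𝕂^{m×n}. Let C = H ∘ R be the lifted convolution operator associated with Q and let Ĥ(v) = Σ_{k ∈ ZMod μ} S_k (U v_k). Suppose: (i) Δ ≥ 0 satisfies |‖Ĥ(A w)‖² − ‖A w‖²| ≤ Δ ‖A w‖² for every (s,σ)-sparse block vector w : ZMod μ → 𝕂^n (A w being the blockwise application); (ii) δ ≥ 0 satisfies |‖A x‖² − ‖x‖²| ≤ δ ‖x‖² for every σ-sparse x ∈ 𝕂^n. Then for every (s,σ)-sparse block vector w : ZMod μ → 𝕂^n one has |‖C(w)‖² − ‖w‖²| ≤ (Δ(1+δ) + δ) ‖w‖², i.e. the lifted convolution operator C satisfies the (s,σ)-HiRIP with constant Δ(1+δ)+δ. -/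

import Mathlib

open Finset

/-- Squared Euclidean norm of a vector: `‖x‖² = Σ_i ‖x_i‖²`. -/
noncomputable def sqNorm {𝕂 : Type*} [RCLike 𝕂] {ι : Type*} [Fintype ι]
    (x : ι → 𝕂) : ℝ :=
  ∑ i, ‖x i‖ ^ 2

/-- Squared norm of a block vector: `‖w‖² = Σ_k ‖w_k‖²`. -/
noncomputable def blockSqNorm {𝕂 : Type*} [RCLike 𝕂] {μ : ℕ} [NeZero μ]
    {ι : Type*} [Fintype ι] (w : ZMod μ → ι → 𝕂) : ℝ :=
  ∑ k : ZMod μ, sqNorm (w k)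

/-- A vector is `σ`-sparse if its support has at most `σ` elements. -/
def SparseVec {𝕂 : Type*} [RCLike 𝕂] {ι : Type*} (σ : ℕ) (x : ι → 𝕂) : Prop :=
  Set.ncard {i | x i ≠ 0} ≤ σ

/-- A block vector is `(s,σ)`-sparse if at most `s` blocks are nonzero and every
block is `σ`-sparse. -/
def HiSparse {𝕂 : Type*} [RCLike 𝕂] {μ n : ℕ} (s σ : ℕ)
    (w : ZMod μ → Fin n → 𝕂) : Prop :=
  Set.ncard {k | w k ≠ 0} ≤ s ∧ ∀ k, SparseVec σ (w k)

/-- The shift operator `S_ℓ`: `(S_ℓ x)_k = x_{k+ℓ}`. -/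
def shiftOp {𝕂 : Type*} [RCLike 𝕂] {μ : ℕ} (ℓ : ZMod μ) (x : ZMod μ → 𝕂) :
    ZMod μ → 𝕂 :=
  fun k => x (k + ℓ)

/-- The lifted operator associated with a matrix `M`: `w ↦ Σ_k S_k (M w_k)`. -/
noncomputable def liftedOp {𝕂 : Type*} [RCLike 𝕂] {μ : ℕ} [NeZero μ]
    {ι : Type*} [Fintype ι] (M : Matrix (ZMod μ) ι 𝕂)
    (w : ZMod μ → ι → 𝕂) : ZMod μ → 𝕂 :=
  ∑ k : ZMod μ, shiftOp k (M.mulVec (w k))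

/-- The reflection operator on block vectors: `(R w)_k = w_{-k}`. -/
def reflOp {μ : ℕ} {α : Type*} (w : ZMod μ → α) : ZMod μ → α :=
  fun k => w (-k)

/-- The lifted convolution operator `C = H ∘ R` associated with `Q`. -/
noncomputable def Cop {𝕂 : Type*} [RCLike 𝕂] {μ n : ℕ} [NeZero μ]
    (Q : Matrix (ZMod μ) (Fin n) 𝕂) (w : ZMod μ → Fin n → 𝕂) : ZMod μ → 𝕂 :=
  liftedOp Q (reflOp w)

/-- Blockwise application of a matrix `A` to a block vector: `(A w)_k = A w_k`. -/
def blockApply {𝕂 : Type*} [RCLike 𝕂] {μ m n : ℕ}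
    (A : Matrix (Fin m) (Fin n) 𝕂) (w : ZMod μ → Fin n → 𝕂) :
    ZMod μ → Fin m → 𝕂 :=
  fun k => A.mulVec (w k)

/-- Reflecting the blocks preserves hierarchical sparsity. -/
theorem HiSparse.reflOp {𝕂 : Type*} [RCLike 𝕂] {μ n : ℕ} {s σ : ℕ}
    {w : ZMod μ → Fin n → 𝕂} (hw : HiSparse s σ w) : HiSparse s σ (reflOp w) := by
  refine ⟨?_, fun k => hw.2 (-k)⟩
  have h : {k | _root_.reflOp w k ≠ 0} = Neg.neg '' {k | w k ≠ 0} := by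
    ext k
    simp [_root_.reflOp]
  rw [h, Set.ncard_image_of_injective _ neg_injective]
  exact hw.1

/-- Reflecting the blocks preserves the norm. -/
theorem blockSqNorm_reflOp {𝕂 : Type*} [RCLike 𝕂] {μ : ℕ} [NeZero μ] {ι : Type*} [Fintype ι]
    (w : ZMod μ → ι → 𝕂) : blockSqNorm (reflOp w) = blockSqNorm w :=
  Equiv.sum_comp (Equiv.neg (ZMod μ)) fun k => sqNorm (w k)

/-- The lifted convolution operator of a product `U * A` factors through blockwise `A`. -/
theorem Cop_mul {𝕂 : Type*} [RCLike 𝕂] {μ m n : ℕ} [NeZero μ]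
    (U : Matrix (ZMod μ) (Fin m) 𝕂) (A : Matrix (Fin m) (Fin n) 𝕂) (w : ZMod μ → Fin n → 𝕂) :
    Cop (U * A) w = liftedOp U (blockApply A (reflOp w)) := by
  simp [Cop, liftedOp, blockApply, Matrix.mulVec_mulVec]

/-- A restricted isometry bound for `A` passes to its blockwise application. -/
theorem abs_blockSqNorm_blockApply_sub_le {𝕂 : Type*} [RCLike 𝕂] {μ m n : ℕ} [NeZero μ]
    (A : Matrix (Fin m) (Fin n) 𝕂) {σ : ℕ} {δ : ℝ}
    (hA : ∀ x : Fin n → 𝕂, SparseVec σ x → |sqNorm (A.mulVec x) - sqNorm x| ≤ δ * sqNorm x)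
    {w : ZMod μ → Fin n → 𝕂} (hw : ∀ k, SparseVec σ (w k)) :
    |blockSqNorm (blockApply A w) - blockSqNorm w| ≤ δ * blockSqNorm w := by
  unfold blockSqNorm blockApply
  rw [← Finset.sum_sub_distrib, Finset.mul_sum]
  exact (Finset.abs_sum_le_sum_abs _ _).trans (Finset.sum_le_sum fun k _ => hA _ (hw k))

/-- if `Q = U A`, `Ĥ` built from `U` satisfies the restricted bound
`Δ` on images of `(s,σ)`-sparse block vectors under blockwise `A`, and `A` has
`σ`-RIP constant `δ`, then the lifted convolution operator `C = H ∘ R`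
satisfies the `(s,σ)`-HiRIP with constant `Δ(1+δ)+δ`. -/
theorem Cop_HiRIP {𝕂 : Type*} [RCLike 𝕂] {μ m n : ℕ} [NeZero μ]
    (U : Matrix (ZMod μ) (Fin m) 𝕂) (A : Matrix (Fin m) (Fin n) 𝕂)
    (s σ : ℕ) (Δ δ : ℝ) (hΔ : 0 ≤ Δ) (hδ : 0 ≤ δ)
    (hU : ∀ w : ZMod μ → Fin n → 𝕂, HiSparse s σ w →
      |sqNorm (liftedOp U (blockApply A w)) - blockSqNorm (blockApply A w)| ≤
        Δ * blockSqNorm (blockApply A w))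
    (hA : ∀ x : Fin n → 𝕂, SparseVec σ x →
      |sqNorm (A.mulVec x) - sqNorm x| ≤ δ * sqNorm x) :
    ∀ w : ZMod μ → Fin n → 𝕂, HiSparse s σ w →
      |sqNorm (Cop (U * A) w) - blockSqNorm w| ≤
        (Δ * (1 + δ) + δ) * blockSqNorm w := by
  intro w hw
  have hr := hw.reflOp
  have hCA := Cop_mul U A w
  have h1 := hU _ hr
  have h2 := abs_blockSqNorm_blockApply_sub_le A hA hr.2
  rw [blockSqNorm_reflOp] at h2
  rw [hCA]
  have hub := (abs_le.mp h2).2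
  have h3 : Δ * blockSqNorm (blockApply A (reflOp w)) ≤ Δ * ((1 + δ) * blockSqNorm w) :=
    mul_le_mul_of_nonneg_left (by linarith) hΔ
  calc |sqNorm (liftedOp U (blockApply A (reflOp w))) - blockSqNorm w|
      ≤ |sqNorm (liftedOp U (blockApply A (reflOp w))) - blockSqNorm (blockApply A (reflOp w))|
        + |blockSqNorm (blockApply A (reflOp w)) - blockSqNorm w| := abs_sub_le _ _ _
    _ ≤ (Δ * (1 + δ) + δ) * blockSqNorm w := by linarith
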